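/- arXiv:2605.26067 — 2 statements merged into one kernel-verified Lean document; each statement's English description precedes it below -/
import Mathlib

section
/- Let K be a symmetric continuous kernel on a compact set X that is conditionally positive definite with respect to F = span{f_1,...,f_k}, and let P be a Borel probability measure on X for which the Gram matrix G = [⟨fᵢ,fⱼ⟩_{L²(X,P)}] is invertible. Let Π_P denote the orthogonal projection onto F in L²(X,P), with kernel Π(x,y) = ∑ᵢⱼ (G⁻¹)ᵢⱼ fᵢ(x)fⱼ(y). Define the residual kernel K_P(x,y) = K(x,y) − Π_P[K(x,·)](y evaluated) − Π_P[K(·,y)](x evaluated) + Π_P[Π_P[K(x,·)](·)](x,y), i.e., K_P = ((I−Π_P)⊗(I−Π_P))[K]. Then K_P is a positive definite kernel: for all x_1,...,x_n ∈ X and α ∈ ℝⁿ, ∑ᵢⱼ αᵢαⱼ K_P(xᵢ,xⱼ) ≥ 0. -/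
open MeasureTheory

/-- A positive semidefinite real kernel admits a feature map into a Hilbert space. -/
lemma exists_featureMap.{u} {X : Type u} (K : X → X → ℝ) (hsymm : ∀ x y, K x y = K y x)
    (hpos : ∀ v : X →₀ ℝ, 0 ≤ v.sum fun x a => v.sum fun y b => a * b * K x y) :
    ∃ (H : Type u) (_ : NormedAddCommGroup H) (_ : InnerProductSpace ℝ H) (_ : CompleteSpace H)
      (φ : X → H), ∀ x y, inner ℝ (φ x) (φ y) = K x y := by
  let M : Matrix X X (ℝ →L[ℝ] ℝ) := .of fun x y => K x y • ContinuousLinearMap.id ℝ ℝ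
  have hM : M.PosSemidef := by
    refine ((RKHS.posSemidef_tfae (K := M)).out 0 2 :
      M.PosSemidef ↔ M.IsHermitian ∧ ∀ v : X →₀ ℝ, 0 ≤ RCLike.re
        (v.sum fun x a => v.sum fun y c => inner ℝ (M y x a) c)).mpr ⟨?_, fun v => ?_⟩
    · ext x y
      have hid : ContinuousLinearMap.adjoint (ContinuousLinearMap.id ℝ ℝ) = .id ℝ ℝ :=
        ContinuousLinearMap.adjoint_id
      simp [M, ContinuousLinearMap.star_eq_adjoint, hsymm x y, hid]
    · refine (hpos v).trans_eq ?_
      simp only [RCLike.re_to_real]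
      refine Finsupp.sum_congr fun x _ => Finsupp.sum_congr fun y _ => ?_
      simp [M, hsymm x y]
      ring
  have : Fact M.PosSemidef := ⟨hM⟩
  refine ⟨RKHS.OfKernel M, inferInstance, inferInstance, inferInstance,
    fun x => RKHS.kerFun (RKHS.OfKernel M) x 1, fun x y => ?_⟩
  rw [← RKHS.kernel_inner, RKHS.OfKernel.kernel_ofKernel]
  simp [M, hsymm x y]

lemma continuous_featureMap {X H : Type*} [TopologicalSpace X] [NormedAddCommGroup H]
    [InnerProductSpace ℝ H] {φ : X → H}
    (h : Continuous fun p : X × X => inner ℝ (φ p.1) (φ p.2)) : Continuous φ := by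
  rw [continuous_iff_continuousAt]
  intro x
  rw [ContinuousAt, tendsto_iff_norm_sub_tendsto_zero]
  have hsq : Continuous fun y => ‖φ y - φ x‖ ^ 2 := by
    have h₁ : Continuous fun y => inner ℝ (φ y) (φ y) :=
      h.comp (continuous_id.prodMk continuous_id)
    have h₂ : Continuous fun y => inner ℝ (φ y) (φ x) :=
      h.comp (continuous_id.prodMk continuous_const)
    simp only [norm_sub_sq_real, ← real_inner_self_eq_norm_sq (φ _)]
    fun_prop
  have hlim := (hsq.sqrt).tendsto x
  simpa using hlim

/-- Linearly independent functions have a dual family of finitely supported functionals. -/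
lemma exists_dual_finsupp {X ι : Type*} [Fintype ι] [DecidableEq ι] (f : ι → X → ℝ)
    (hf : LinearIndependent ℝ f) :
    ∃ l : ι → X →₀ ℝ, ∀ i j, Finsupp.linearCombination ℝ (f i) (l j) = if i = j then 1 else 0 := by
  have hspan : Submodule.span ℝ (Set.range fun x i => f i x) = (⊤ : Submodule ℝ (ι → ℝ)) := by
    by_contra hne
    obtain ⟨ψ, hψ, hψ'⟩ :=
      Submodule.exists_dual_map_eq_bot_of_lt_top (lt_top_iff_ne_top.mpr hne) inferInstance
    have hzero : ∀ x, ψ (fun i => f i x) = 0 := fun x => by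
      have := Submodule.mem_map_of_mem (f := ψ)
        (Submodule.subset_span (R := ℝ) (Set.mem_range_self (f := fun x i => f i x) x))
      rwa [hψ', Submodule.mem_bot] at this
    have hcoeff := Fintype.linearIndependent_iff.mp hf (fun i => ψ (Pi.single i 1)) (by
      ext x
      have := hzero x
      rw [LinearMap.pi_apply_eq_sum_univ] at this
      simp only [Finset.sum_apply, Pi.smul_apply, smul_eq_mul, Pi.zero_apply]
      rw [← this]
      refine Finset.sum_congr rfl fun i _ => ?_
      rw [smul_eq_mul, mul_comm]
      congr 2
      ext j
      simp [Pi.single_apply, eq_comm])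
    refine hψ (LinearMap.pi_ext' fun i => ?_)
    ext
    simpa using hcoeff i
  have hmem : ∀ j, ∃ l : X →₀ ℝ, Finsupp.linearCombination ℝ (fun x i => f i x) l =
      Pi.single j (1 : ℝ) := fun j =>
    (Finsupp.mem_span_range_iff_exists_finsupp (R := ℝ)).mp (hspan ▸ Submodule.mem_top)
  choose l hl using hmem
  refine ⟨l, fun i j => ?_⟩
  have := congrFun (hl j) i
  rw [Pi.single_apply] at this
  rw [← this]
  simp [Finsupp.linearCombination_apply, Finsupp.sum, Finset.sum_apply]

/-- A conditionally positive definite kernel becomes positive semidefinite after subtracting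
a symmetric correction built from the functions it is conditioned on. -/
lemma exists_posSemidef_correction {X : Type*} [TopologicalSpace X] {k : ℕ} (f : Fin k → X → ℝ)
    (hfc : ∀ i, Continuous (f i)) (hli : LinearIndependent ℝ f)
    (K : X → X → ℝ) (hKsymm : ∀ x y, K x y = K y x)
    (hKcont : Continuous fun p : X × X => K p.1 p.2)
    (hCPD : ∀ (n : ℕ) (x : Fin n → X) (α : Fin n → ℝ),
        (∀ g ∈ Submodule.span ℝ (Set.range f), ∑ i, α i * g (x i) = 0) →
        0 ≤ ∑ i, ∑ j, α i * α j * K (x i) (x j)) :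
    ∃ b : Fin k → X → ℝ, (∀ j, Continuous (b j)) ∧
      ∀ v : X →₀ ℝ, 0 ≤ v.sum fun x a => v.sum fun y c =>
        a * c * (K x y - ∑ j, (f j x * b j y + b j x * f j y)) := by
  obtain ⟨l, hl⟩ := exists_dual_finsupp f hli
  let B : (X →₀ ℝ) →ₗ[ℝ] (X →₀ ℝ) →ₗ[ℝ] ℝ :=
    Finsupp.linearCombination ℝ fun x => Finsupp.linearCombination ℝ (K x)
  have hB : ∀ v w, B v w = v.sum fun x a => w.sum fun y c => a * c * K x y := fun v w => by
    simp [B, Finsupp.linearCombination_apply, Finsupp.sum, LinearMap.sum_apply, Finset.mul_sum,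
      mul_assoc]
  have hBsymm : ∀ v w, B v w = B w v := fun v w => by
    rw [hB, hB, Finsupp.sum_comm]
    refine Finsupp.sum_congr fun x _ => Finsupp.sum_congr fun y _ => ?_
    rw [hKsymm]
    ring
  let E : Fin k → (X →₀ ℝ) →ₗ[ℝ] ℝ := fun i => Finsupp.linearCombination ℝ (f i)
  have hnonneg : ∀ v : X →₀ ℝ, (∀ i, E i v = 0) → 0 ≤ B v v := by
    intro v hv
    let e := v.support.equivFin.symm
    have hsum : ∀ g : X → ℝ, ∑ i, g (e i : X) = ∑ x ∈ v.support, g x := fun g =>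
      (e.sum_comp fun x => g x).trans (Finset.sum_coe_sort v.support g)
    have := hCPD _ (fun i => (e i : X)) (fun i => v (e i)) (fun g hg => by
      rw [hsum fun x => v x * g x]
      induction hg using Submodule.span_induction with
      | mem g hg =>
        obtain ⟨i, rfl⟩ := hg
        simpa [E, Finsupp.linearCombination_apply, Finsupp.sum] using hv i
      | zero => simp
      | add g g' _ _ h h' => simp [mul_add, Finset.sum_add_distrib, h, h']
      | smul c g _ h =>
        simp only [Pi.smul_apply, smul_eq_mul, mul_left_comm _ c, ← Finset.mul_sum, h, mul_zero])
    refine this.trans_eq ?_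
    rw [hB]
    simp only [Finsupp.sum]
    rw [← hsum fun x => ∑ y ∈ v.support, v x * v y * K x y]
    exact Finset.sum_congr rfl fun i _ => hsum fun y => v (e i) * v y * K (e i) y
  let b : Fin k → X → ℝ := fun j x =>
    B (l j) (Finsupp.single x 1) - (1 / 2) * ∑ i, B (l j) (l i) * f i x
  have hb : ∀ j v, v.sum (fun x a => a * b j x) =
      B (l j) v - (1 / 2) * ∑ i, B (l j) (l i) * E i v := fun j v => by
    have : Finsupp.linearCombination ℝ (b j) =
        B (l j) - (1 / 2 : ℝ) • ∑ i, B (l j) (l i) • E i := by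
      ext x
      simp [b, E]
    have h := LinearMap.congr_fun this v
    rw [Finsupp.linearCombination_apply] at h
    simpa using h
  refine ⟨b, fun j => ?_, fun v => ?_⟩
  · have : Continuous fun x => B (l j) (Finsupp.single x 1) := by
      simp only [hB, mul_zero, zero_mul, Finsupp.sum_single_index, mul_one]
      refine continuous_finsetSum _ fun y _ => ?_
      fun_prop
    simp only [b]
    exact this.sub (by fun_prop)
  · have hT := hnonneg (v - ∑ j, E j v • l j) fun i => by
      simp [map_sub, map_sum, E, hl]
    refine hT.trans_eq ?_
    have hE : ∀ j, v.sum (fun x a => a * f j x) = E j v := fun j => by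
      simp [E, Finsupp.linearCombination_apply]
    have hsum : (v.sum fun x a => v.sum fun y c =>
        a * c * (K x y - ∑ j, (f j x * b j y + b j x * f j y))) =
        B v v - ∑ j, 2 * (E j v * (B (l j) v - (1 / 2) * ∑ i, B (l j) (l i) * E i v)) := by
      simp only [← hb]
      simp only [hB, ← hE, Finsupp.sum, mul_sub, Finset.sum_sub_distrib]
      congr 1
      simp only [Finset.mul_sum (s := Finset.univ)]
      rw [Finset.sum_congr rfl fun x _ => Finset.sum_comm, Finset.sum_comm]
      refine Finset.sum_congr rfl fun j _ => ?_
      simp only [two_mul, mul_add, Finset.sum_add_distrib]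
      congr 1
      · rw [Finset.sum_mul_sum]
        exact Finset.sum_congr rfl fun x _ => Finset.sum_congr rfl fun y _ => by ring
      · rw [mul_comm, Finset.sum_mul_sum]
        exact Finset.sum_congr rfl fun x _ => Finset.sum_congr rfl fun y _ => by ring
    rw [hsum]
    set w := ∑ j, E j v • l j with hw
    have hwv : B w v = ∑ j, E j v * B (l j) v := by
      simp [hw, LinearMap.sum_apply]
    have hww : B w w = ∑ j, E j v * ∑ i, B (l j) (l i) * E i v := by
      simp only [hw, map_sum, map_smul, LinearMap.sum_apply,
        LinearMap.smul_apply, smul_eq_mul]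
      refine Finset.sum_congr rfl fun j _ => ?_
      congr 1
      exact Finset.sum_congr rfl fun i _ => by rw [hBsymm, mul_comm]
    rw [map_sub B, LinearMap.sub_apply, map_sub, map_sub, hBsymm v w, hww, hwv, sub_sub,
      sub_right_inj, ← add_sub_assoc, ← Finset.sum_add_distrib, ← Finset.sum_sub_distrib]
    exact Finset.sum_congr rfl fun j _ => by ring

/-- The kernel projection built from the inverse Gram matrix fixes the spanning functions. -/
lemma integral_gramKernel_mul {X ι : Type*} [Fintype ι] [DecidableEq ι] [MeasurableSpace X]
    {P : Measure X} (f : ι → X → ℝ) (hint : ∀ i j, Integrable (fun x => f i x * f j x) P)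
    (G : Matrix ι ι ℝ) (hG : ∀ i j, G i j = ∫ x, f i x * f j x ∂P) (hGinv : IsUnit G.det)
    (x : X) (m : ι) :
    ∫ s, (∑ i, ∑ j, G⁻¹ i j * f i x * f j s) * f m s ∂P = f m x := by
  have h : ∀ s, (∑ i, ∑ j, G⁻¹ i j * f i x * f j s) * f m s =
      ∑ i, ∑ j, G⁻¹ i j * f i x * (f j s * f m s) := fun s => by
    simp only [Finset.sum_mul, mul_assoc]
  simp_rw [h]
  rw [integral_finsetSum _ fun i _ => integrable_finsetSum _ fun j _ => (hint j m).const_mul _]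
  have h' : ∀ i, ∫ s, ∑ j, G⁻¹ i j * f i x * (f j s * f m s) ∂P = (G⁻¹ * G) i m * f i x := by
    intro i
    rw [integral_finsetSum _ fun j _ => (hint j m).const_mul _, Matrix.mul_apply, Finset.sum_mul]
    refine Finset.sum_congr rfl fun j _ => ?_
    rw [integral_const_mul, hG]
    ring
  simp_rw [h', Matrix.nonsing_inv_mul G hGinv, Matrix.one_apply]
  simp

/-- If `K` is a symmetric continuous kernel on a compact `X ⊆ ℝ^d`
that is conditionally positive definite w.r.t. `F = span{f_1,…,f_k}` and `P` is an
`F`-nondegenerate Borel probability measure (the Gram matrix `G` is invertible),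
then the residual kernel `K_P = ((I−Π_P)⊗(I−Π_P))[K]` is positive definite. -/
theorem residual_kernel_posDef
    {d k : ℕ} {X : Set (EuclideanSpace ℝ (Fin d))} (hX : IsCompact X)
    (f : Fin k → X → ℝ) (hfc : ∀ i, Continuous (f i)) (hli : LinearIndependent ℝ f)
    (K : X → X → ℝ) (hKsymm : ∀ x y, K x y = K y x)
    (hKcont : Continuous fun p : X × X => K p.1 p.2)
    (hCPD : ∀ (n : ℕ) (x : Fin n → X) (α : Fin n → ℝ),
        (∀ g ∈ Submodule.span ℝ (Set.range f), ∑ i, α i * g (x i) = 0) →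
        0 ≤ ∑ i, ∑ j, α i * α j * K (x i) (x j))
    (P : Measure X) [IsProbabilityMeasure P]
    (G : Matrix (Fin k) (Fin k) ℝ)
    (hG : ∀ i j, G i j = ∫ x, f i x * f j x ∂P)
    (hGinv : IsUnit G.det)
    (Pk : X → X → ℝ)
    (hPk : ∀ x y, Pk x y = ∑ i, ∑ j, G⁻¹ i j * f i x * f j y)
    (KP : X → X → ℝ)
    (hKP : ∀ x y, KP x y = K x y - (∫ s, Pk x s * K s y ∂P)
        - (∫ t, Pk y t * K x t ∂P)
        + ∫ s, ∫ t, Pk x s * K s t * Pk y t ∂P ∂P) :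
    ∀ (n : ℕ) (x : Fin n → X) (α : Fin n → ℝ),
      0 ≤ ∑ i, ∑ j, α i * α j * KP (x i) (x j) := by
  have : CompactSpace X := isCompact_iff_compactSpace.mp hX
  obtain ⟨b, hbc, hpos⟩ := exists_posSemidef_correction f hfc hli K hKsymm hKcont hCPD
  obtain ⟨H, _, _, _, φ, hφ⟩ := exists_featureMap
    (fun x y => K x y - ∑ j, (f j x * b j y + b j x * f j y))
    (fun x y => by
      simp only [hKsymm x y]
      congr 1
      exact Finset.sum_congr rfl fun j _ => by ring) hpos
  have hφc : Continuous φ := continuous_featureMap (by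
    simp only [hφ]
    fun_prop)
  have hK : ∀ x y, K x y = inner ℝ (φ x) (φ y) + ∑ j, (f j x * b j y + b j x * f j y) :=
    fun x y => by rw [hφ]; ring
  have hPkc : ∀ x, Continuous (Pk x) := fun x => by
    rw [show Pk x = _ from funext (hPk x)]
    fun_prop
  have hint : ∀ {E : Type _} [NormedAddCommGroup E] {g : X → E}, Continuous g → Integrable g P :=
    fun hg => hg.integrable_of_hasCompactSupport (HasCompactSupport.of_compactSpace _)
  have hproj : ∀ x m, ∫ s, Pk x s * f m s ∂P = f m x := fun x m => by
    simp only [hPk]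
    exact integral_gramKernel_mul f (fun i j => hint (by fun_prop)) G hG hGinv x m
  let q : Fin k → X → ℝ := fun j x => ∫ s, Pk x s * b j s ∂P
  let Φ : X → H := fun x => ∫ s, Pk x s • φ s ∂P
  have hΦ : ∀ x (u : H), ∫ s, Pk x s * inner ℝ u (φ s) ∂P = inner ℝ u (Φ x) := fun x u => by
    rw [← integral_inner (hint (by have := hPkc x; fun_prop))]
    simp only [inner_smul_right]
  have hright : ∀ x y, ∫ t, Pk y t * K x t ∂P =
      inner ℝ (φ x) (Φ y) + ∑ j, (f j x * q j y + b j x * f j y) := by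
    intro x y
    have := hPkc y
    have h : ∀ t, Pk y t * K x t = Pk y t * inner ℝ (φ x) (φ t) +
        ∑ j, (f j x * (Pk y t * b j t) + b j x * (Pk y t * f j t)) := fun t => by
      rw [hK, mul_add, Finset.mul_sum]
      congr 1
      exact Finset.sum_congr rfl fun j _ => by ring
    simp_rw [h]
    rw [integral_add (hint (by fun_prop)) (hint (by fun_prop)), hΦ,
      integral_finsetSum _ fun j _ => hint (by fun_prop)]
    congr 1
    refine Finset.sum_congr rfl fun j _ => ?_
    rw [integral_add (hint (by fun_prop)) (hint (by fun_prop)), integral_const_mul,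
      integral_const_mul, hproj]
  have hleft : ∀ x y, ∫ s, Pk x s * K s y ∂P =
      inner ℝ (Φ x) (φ y) + ∑ j, (f j x * b j y + q j x * f j y) := fun x y => by
    simp_rw [fun s => hKsymm s y]
    rw [hright, real_inner_comm]
    congr 1
    exact Finset.sum_congr rfl fun j _ => by ring
  have hdouble : ∀ x y, ∫ s, ∫ t, Pk x s * K s t * Pk y t ∂P ∂P =
      inner ℝ (Φ x) (Φ y) + ∑ j, (f j x * q j y + q j x * f j y) := by
    intro x y
    have := hPkc x
    have h : ∀ s, ∫ t, Pk x s * K s t * Pk y t ∂P = Pk x s * inner ℝ (Φ y) (φ s) +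
        ∑ j, (q j y * (Pk x s * f j s) + f j y * (Pk x s * b j s)) := fun s => by
      simp_rw [mul_assoc, fun t => mul_comm (K s t) (Pk y t)]
      rw [integral_const_mul, hright, mul_add, Finset.mul_sum, real_inner_comm]
      congr 1
      exact Finset.sum_congr rfl fun j _ => by ring
    simp_rw [h]
    rw [integral_add (hint (by fun_prop)) (hint (by fun_prop)), hΦ,
      integral_finsetSum _ fun j _ => hint (by fun_prop), real_inner_comm]
    congr 1
    refine Finset.sum_congr rfl fun j _ => ?_
    rw [integral_add (hint (by fun_prop)) (hint (by fun_prop)), integral_const_mul,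
      integral_const_mul, hproj]
    ring
  have hKP' : ∀ x y, KP x y = inner ℝ (φ x - Φ x) (φ y - Φ y) := fun x y => by
    rw [hKP, hleft, hright, hdouble, hK]
    simp only [inner_sub_left, inner_sub_right, Finset.sum_add_distrib]
    ring
  intro n x α
  have hsq : ∑ i, ∑ j, α i * α j * KP (x i) (x j) =
      inner ℝ (∑ i, α i • (φ (x i) - Φ (x i))) (∑ i, α i • (φ (x i) - Φ (x i))) := by
    simp only [sum_inner, inner_sum, real_inner_smul_left, real_inner_smul_right, hKP', mul_assoc]
    exact Finset.sum_congr rfl fun i _ => Finset.sum_congr rfl fun j _ => by rw [real_inner_comm]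
  rw [hsq]
  exact real_inner_self_nonneg
end

section
/- Under the setting of the previous statement, with probability at least 1 − 2k·exp(−N/((28/3)kM² + 4/3)) the following both hold: ‖((1/N)FFᵀ)⁻¹‖_op ≤ 2 and ‖((1/N)FFᵀ)⁻¹‖_op · ‖F‖_op ≤ √(6N), where F = [fᵢ(Xⱼ)] ∈ ℝ^{k×N}. -/
open MeasureTheory Matrix

/-- The ℓ²→ℓ² operator norm of a real matrix. -/
noncomputable def matOpNorm {m n : ℕ} (A : Matrix (Fin m) (Fin n) ℝ) : ℝ :=
  ‖LinearMap.toContinuousLinearMap (Matrix.toEuclideanLin A)‖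

section Trace

variable {m : Type*} [Fintype m] [DecidableEq m]

theorem Matrix.trace_mul_pow_comm (A B : Matrix m m ℝ) (n : ℕ) :
    ((A * B) ^ n).trace = ((B * A) ^ n).trace := by
  cases n with
  | zero => simp
  | succ n =>
    have h : ∀ j : ℕ, (A * B) ^ j * A = A * (B * A) ^ j := by
      intro j
      induction j with
      | zero => simp
      | succ j ih => rw [pow_succ', mul_assoc, ih, pow_succ']; simp only [mul_assoc]
    rw [pow_succ, ← mul_assoc, h, mul_assoc, trace_mul_comm, mul_assoc, ← pow_succ]

omit [DecidableEq m] in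
theorem Matrix.trace_transpose_mul_self_nonneg (Z : Matrix m m ℝ) : 0 ≤ (Zᵀ * Z).trace := by
  simpa using (Matrix.posSemidef_conjTranspose_mul_self Z).trace_nonneg

omit [DecidableEq m] in
theorem Matrix.trace_mul_self_le (X : Matrix m m ℝ) : (X * X).trace ≤ (Xᵀ * X).trace := by
  have h := trace_transpose_mul_self_nonneg (X - Xᵀ)
  have h1 : (Xᵀ * Xᵀ).trace = (X * X).trace := by rw [← transpose_mul, trace_transpose]
  have h2 : (X * Xᵀ).trace = (Xᵀ * X).trace := trace_mul_comm _ _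
  simp only [transpose_sub, transpose_transpose, sub_mul, mul_sub, trace_sub] at h
  linarith

omit [DecidableEq m] in
theorem Matrix.two_mul_trace_mul_le {P Q : Matrix m m ℝ} (hP : Pᵀ = P) (hQ : Qᵀ = Q) :
    2 * (P * Q).trace ≤ (P * P).trace + (Q * Q).trace := by
  have h := trace_transpose_mul_self_nonneg (P - Q)
  have h2 : (Q * P).trace = (P * Q).trace := trace_mul_comm _ _
  simp only [transpose_sub, hP, hQ, sub_mul, mul_sub, trace_sub] at h
  linarith

theorem Matrix.trace_pow_two_pow_aux (n : ℕ) :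
    (∀ X : Matrix m m ℝ, (X ^ 2 ^ (n + 1)).trace ≤ ((Xᵀ * X) ^ 2 ^ n).trace) ∧
    ∀ A B : Matrix m m ℝ, Aᵀ = A → Bᵀ = B →
      ((A * B) ^ 2 ^ n).trace ≤ (A ^ 2 ^ n * B ^ 2 ^ n).trace := by
  induction n with
  | zero => exact ⟨fun X => by simpa [pow_two] using trace_mul_self_le X, fun A B _ _ => by simp⟩
  | succ n ih =>
    obtain ⟨ih₁, ih₂⟩ := ih
    refine ⟨fun X => ?_, fun A B hA hB => ?_⟩
    · have hP : (X * Xᵀ)ᵀ = X * Xᵀ := by simp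
      have hQ : (Xᵀ * X)ᵀ = Xᵀ * X := by simp
      have h1 := ih₁ (X * X)
      have h2 := ih₂ _ _ hQ hP
      have h3 := two_mul_trace_mul_le (P := (Xᵀ * X) ^ 2 ^ n) (Q := (X * Xᵀ) ^ 2 ^ n)
        (by rw [transpose_pow, hQ]) (by rw [transpose_pow, hP])
      have h4 : (((X * X)ᵀ * (X * X)) ^ 2 ^ n).trace = ((Xᵀ * X * (X * Xᵀ)) ^ 2 ^ n).trace := by
        rw [transpose_mul, mul_assoc, trace_mul_pow_comm]
        simp only [mul_assoc]
      have h5 : ((X * Xᵀ) ^ 2 ^ (n + 1)).trace = ((Xᵀ * X) ^ 2 ^ (n + 1)).trace :=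
        trace_mul_pow_comm _ _ _
      simp only [← pow_add, ← two_mul, ← pow_succ'] at h3
      rw [← pow_two, ← pow_mul, ← pow_succ'] at h1
      rw [← pow_two] at h4
      linarith
    · have h1 := ih₁ (A * B)
      have h2 := ih₂ (A * A) (B * B) (by simp [hA]) (by simp [hB])
      have h3 : (((A * B)ᵀ * (A * B)) ^ 2 ^ n).trace = ((A * A * (B * B)) ^ 2 ^ n).trace := by
        rw [transpose_mul, hA, hB, mul_assoc, trace_mul_pow_comm]
        simp only [mul_assoc]
      rw [← pow_two, ← pow_two, ← pow_mul, ← pow_mul, ← pow_succ', pow_two, pow_two] at h2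
      linarith

/-- A power-of-two Lieb–Thirring trace inequality for symmetric matrices. -/
theorem Matrix.trace_mul_pow_two_pow_le {A B : Matrix m m ℝ} (hA : Aᵀ = A) (hB : Bᵀ = B) (n : ℕ) :
    ((A * B) ^ 2 ^ n).trace ≤ (A ^ 2 ^ n * B ^ 2 ^ n).trace :=
  (trace_pow_two_pow_aux n).2 A B hA hB

end Trace

section LieProduct

open NormedSpace Filter Topology

variable {𝔸 : Type*} [NormedRing 𝔸] [NormOneClass 𝔸]

theorem norm_pow_sub_pow_le {x y : 𝔸} {c : ℝ} (hc : 1 ≤ c) (hx : ‖x‖ ≤ c) (hy : ‖y‖ ≤ c) (n : ℕ) :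
    ‖x ^ n - y ^ n‖ ≤ n * c ^ n * ‖x - y‖ := by
  induction n with
  | zero => simp
  | succ n ih =>
    have hc0 : 0 ≤ c := by linarith
    have hcn : 0 ≤ c ^ n := by positivity
    have hxn : ‖x ^ n‖ ≤ c ^ n := (norm_pow_le x n).trans (by gcongr)
    calc ‖x ^ (n + 1) - y ^ (n + 1)‖ = ‖x ^ n * (x - y) + (x ^ n - y ^ n) * y‖ := by
          congr 1; rw [pow_succ, pow_succ]; noncomm_ring
      _ ≤ ‖x ^ n‖ * ‖x - y‖ + ‖x ^ n - y ^ n‖ * ‖y‖ :=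
          (norm_add_le _ _).trans (add_le_add (norm_mul_le _ _) (norm_mul_le _ _))
      _ ≤ c ^ n * ‖x - y‖ + (n * c ^ n * ‖x - y‖) * c := by gcongr
      _ ≤ c ^ n * c * ‖x - y‖ + (n * c ^ n * ‖x - y‖) * c := by
          gcongr; exact le_mul_of_one_le_right hcn hc
      _ = _ := by push_cast; ring

variable [NormedAlgebra ℝ 𝔸] [CompleteSpace 𝔸]

theorem NormedSpace.norm_exp_le_exp_norm (x : 𝔸) : ‖exp x‖ ≤ Real.exp ‖x‖ := by
  have h := exp_series_hasSum_exp' (𝕂 := ℝ) x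
  have h' := exp_series_hasSum_exp' (𝕂 := ℝ) ‖x‖
  rw [← Real.exp_eq_exp_ℝ] at h'
  refine h.norm_le_of_bounded h' fun n => ?_
  rw [norm_smul, Real.norm_of_nonneg (by positivity), smul_eq_mul]
  gcongr
  exact norm_pow_le x n

/-- The Lie product formula. -/
theorem NormedSpace.tendsto_exp_mul_exp_pow (a b : 𝔸) :
    Tendsto (fun n : ℕ => (exp ((n : ℝ)⁻¹ • a) * exp ((n : ℝ)⁻¹ • b)) ^ n) atTop
      (𝓝 (exp (a + b))) := by
  let : NormedAlgebra ℚ 𝔸 := NormedAlgebra.restrictScalars ℚ ℝ 𝔸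
  set g : ℝ → 𝔸 := fun t => exp (t • a) * exp (t • b) - exp (t • (a + b)) with hg
  have hder : HasDerivAt g 0 0 := by
    have h := ((hasDerivAt_exp_smul_const a (0 : ℝ)).mul
      (hasDerivAt_exp_smul_const b (0 : ℝ))).sub (hasDerivAt_exp_smul_const (a + b) (0 : ℝ))
    convert! h using 1
    simp
  have hlim : Tendsto (fun n : ℕ => (n : ℝ) * ‖g ((n : ℝ)⁻¹)‖) atTop (𝓝 0) := by
    have h1 := hder.tendsto_slope_zero
    have h2 : Tendsto (fun n : ℕ => ((n : ℝ)⁻¹)) atTop (𝓝[≠] 0) := by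
      refine tendsto_nhdsWithin_iff.2 ⟨tendsto_inv_atTop_nhds_zero_nat, ?_⟩
      filter_upwards [eventually_gt_atTop 0] with n hn
      simp [hn.ne']
    have h3 := (h1.comp h2).norm
    simpa [hg, norm_smul] using h3
  set K := Real.exp (‖a‖ + ‖b‖) with hK
  rw [tendsto_iff_norm_sub_tendsto_zero]
  refine squeeze_zero' (g := fun n : ℕ => K * ((n : ℝ) * ‖g ((n : ℝ)⁻¹)‖))
    (Eventually.of_forall fun _ => norm_nonneg _) ?_ (by simpa using hlim.const_mul K)
  filter_upwards [eventually_gt_atTop 0] with n hn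
  have hn' : (n : ℝ) ≠ 0 := by positivity
  have hpow : exp (a + b) = exp ((n : ℝ)⁻¹ • (a + b)) ^ n := by
    rw [← exp_nsmul, ← Nat.cast_smul_eq_nsmul ℝ, smul_smul, mul_inv_cancel₀ hn', one_smul]
  have hnorm : ∀ x : 𝔸, ‖exp ((n : ℝ)⁻¹ • x)‖ ≤ Real.exp ((n : ℝ)⁻¹ * ‖x‖) := fun x => by
    refine (norm_exp_le_exp_norm _).trans_eq ?_
    rw [norm_smul, Real.norm_of_nonneg (by positivity)]
  have hX : ‖exp ((n : ℝ)⁻¹ • a) * exp ((n : ℝ)⁻¹ • b)‖ ≤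
      Real.exp ((n : ℝ)⁻¹ * (‖a‖ + ‖b‖)) := by
    rw [mul_add, Real.exp_add]
    exact (norm_mul_le _ _).trans (by gcongr <;> exact hnorm _)
  have hY : ‖exp ((n : ℝ)⁻¹ • (a + b))‖ ≤ Real.exp ((n : ℝ)⁻¹ * (‖a‖ + ‖b‖)) :=
    (hnorm _).trans (by gcongr; exact norm_add_le _ _)
  rw [hpow]
  refine (norm_pow_sub_pow_le (Real.one_le_exp (by positivity)) hX hY n).trans_eq ?_
  rw [← Real.exp_nat_mul, ← mul_assoc (n : ℝ) (n : ℝ)⁻¹, mul_inv_cancel₀ hn', one_mul]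
  simp only [hg, hK]
  ring

end LieProduct

open scoped Matrix.Norms.Operator in
/-- The Golden–Thompson inequality for real symmetric matrices. -/
theorem Matrix.trace_exp_add_le {m : Type*} [Fintype m] [DecidableEq m] {A B : Matrix m m ℝ}
    (hA : Aᵀ = A) (hB : Bᵀ = B) :
    (NormedSpace.exp (A + B)).trace ≤ (NormedSpace.exp A * NormedSpace.exp B).trace := by
  cases isEmpty_or_nonempty m
  · simp [Matrix.trace]
  have h := (NormedSpace.tendsto_exp_mul_exp_pow A B).comp
    (tendsto_pow_atTop_atTop_of_one_lt (one_lt_two : (1 : ℕ) < 2))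
  have h' := (continuous_id.matrix_trace.tendsto _).comp h
  refine le_of_tendsto' h' fun n => ?_
  have hpow : ∀ C : Matrix m m ℝ,
      NormedSpace.exp (((2 ^ n : ℕ) : ℝ)⁻¹ • C) ^ 2 ^ n = NormedSpace.exp C := fun C => by
    rw [← Matrix.exp_nsmul, ← Nat.cast_smul_eq_nsmul ℝ, smul_smul,
      mul_inv_cancel₀ (by positivity), one_smul]
  have hsymm : ∀ C : Matrix m m ℝ, Cᵀ = C →
      (NormedSpace.exp (((2 ^ n : ℕ) : ℝ)⁻¹ • C))ᵀ = NormedSpace.exp (((2 ^ n : ℕ) : ℝ)⁻¹ • C) :=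
    fun C hC => by rw [← Matrix.exp_transpose, transpose_smul, hC]
  refine (trace_mul_pow_two_pow_le (hsymm A hA) (hsymm B hB) n).trans_eq ?_
  rw [hpow, hpow]

section Exp

variable {m : Type*} [Fintype m] [DecidableEq m]

theorem Matrix.posSemidef_exp {A : Matrix m m ℝ} (hA : Aᵀ = A) :
    (NormedSpace.exp A).PosSemidef := by
  have h : NormedSpace.exp A =
      (NormedSpace.exp ((2 : ℝ)⁻¹ • A))ᴴ * NormedSpace.exp ((2 : ℝ)⁻¹ • A) := by
    rw [conjTranspose_eq_transpose_of_trivial, ← exp_transpose, transpose_smul, hA,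
      ← exp_add_of_commute _ _ (Commute.refl _), ← add_smul]
    norm_num
  rw [h]
  exact posSemidef_conjTranspose_mul_self _

theorem Matrix.dotProduct_mulVec_le_of_trace_exp_le {B : Matrix m m ℝ} (hB : Bᵀ = B) {c : ℝ}
    (h : (NormedSpace.exp B).trace ≤ Real.exp c) (u : m → ℝ) :
    u ⬝ᵥ B *ᵥ u ≤ c * (u ⬝ᵥ u) := by
  have hH : B.IsHermitian := by rwa [IsHermitian, conjTranspose_eq_transpose_of_trivial]
  set U : Matrix m m ℝ := (hH.eigenvectorUnitary : Matrix m m ℝ) with hU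
  have hUU : U * Uᵀ = 1 := by
    simpa [star_eq_conjTranspose] using Unitary.coe_mul_star_self hH.eigenvectorUnitary
  have hUU' : Uᵀ * U = 1 := by
    simpa [star_eq_conjTranspose] using Unitary.coe_star_mul_self hH.eigenvectorUnitary
  have hinv : U⁻¹ = Uᵀ := inv_eq_right_inv hUU
  have hspec : B = U * diagonal hH.eigenvalues * Uᵀ := by
    have := hH.spectral_theorem
    rw [Unitary.conjStarAlgAut_apply] at this
    simpa [star_eq_conjTranspose, hU, Function.comp_def] using! this
  have hexp : NormedSpace.exp B = U * diagonal (fun i => Real.exp (hH.eigenvalues i)) * Uᵀ := by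
    conv_lhs => rw [hspec, ← hinv, exp_conj _ _ (IsUnit.of_mul_eq_one _ hUU), hinv, exp_diagonal]
    congr 3
    ext i
    rw [Pi.coe_exp, Real.exp_eq_exp_ℝ]
  have htr : (NormedSpace.exp B).trace = ∑ i, Real.exp (hH.eigenvalues i) := by
    rw [hexp, trace_mul_comm, ← mul_assoc, hUU', one_mul, trace_diagonal]
  have hle : ∀ i, hH.eigenvalues i ≤ c := fun i => by
    rw [← Real.exp_le_exp]
    refine le_trans ?_ (htr ▸ h)
    exact Finset.single_le_sum (f := fun i => Real.exp (hH.eigenvalues i))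
      (fun j _ => (Real.exp_pos _).le) (Finset.mem_univ i)
  have huu : u ⬝ᵥ u = ∑ i, (Uᵀ *ᵥ u) i * (Uᵀ *ᵥ u) i := by
    change _ = (Uᵀ *ᵥ u) ⬝ᵥ (Uᵀ *ᵥ u)
    rw [dotProduct_mulVec, vecMul_mulVec, transpose_transpose, hUU, vecMul_one]
  have huBu : u ⬝ᵥ B *ᵥ u = ∑ i, (Uᵀ *ᵥ u) i * (hH.eigenvalues i * (Uᵀ *ᵥ u) i) := by
    conv_lhs => rw [hspec]
    rw [← mulVec_mulVec, ← mulVec_mulVec, dotProduct_mulVec, ← mulVec_transpose]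
    simp only [dotProduct, mulVec_diagonal]
  rw [huu, huBu, Finset.mul_sum]
  refine Finset.sum_le_sum fun i _ => ?_
  nlinarith [mul_le_mul_of_nonneg_right (hle i) (mul_self_nonneg ((Uᵀ *ᵥ u) i))]

open scoped Matrix.Norms.Operator in
theorem Matrix.exp_smul_of_isIdempotentElem {p : Matrix m m ℝ} (hp : p * p = p) (c : ℝ) :
    NormedSpace.exp (c • p) = 1 + (Real.exp c - 1) • p := by
  have h := NormedSpace.exp_series_hasSum_exp' (𝕂 := ℝ) (c • p)
  have h1 : HasSum (fun n : ℕ => ((n.factorial : ℝ)⁻¹ • c ^ n) • p) (Real.exp c • p) := by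
    have := NormedSpace.exp_series_hasSum_exp' (𝕂 := ℝ) c
    rw [← Real.exp_eq_exp_ℝ] at this
    exact this.smul_const p
  have h2 := h1.add (hasSum_ite_eq (0 : ℕ) (1 - p))
  refine (h.unique (h2.congr_fun ?_)).trans ?_
  · intro n
    cases n with
    | zero => simp
    | succ n =>
      have hpn : p ^ (n + 1) = p := (show IsIdempotentElem p from hp).pow_succ_eq n
      simp [smul_pow, hpn, smul_smul]
  · rw [sub_smul, one_smul]; abel

theorem Real.exp_mul_sub_one_le {θ r R : ℝ} (hr : 0 ≤ r) (hrR : r ≤ R) (hR : 0 < R) :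
    Real.exp (θ * r) - 1 ≤ r * ((Real.exp (θ * R) - 1) / R) := by
  have h := convexOn_exp.2 (Set.mem_univ 0) (Set.mem_univ (θ * R))
    (show 0 ≤ 1 - r / R by rw [sub_nonneg, div_le_one hR]; exact hrR)
    (show 0 ≤ r / R by positivity) (by ring)
  have h2 : r / R * (θ * R) = θ * r := by field_simp
  simp only [smul_eq_mul, mul_zero, zero_add, Real.exp_zero, mul_one, h2] at h
  have h3 : r * ((Real.exp (θ * R) - 1) / R) = r / R * Real.exp (θ * R) - r / R := by ring
  linarith

omit [DecidableEq m] in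
theorem Matrix.trace_mul_vecMulVec (A : Matrix m m ℝ) (v : m → ℝ) :
    (A * vecMulVec v v).trace = v ⬝ᵥ A *ᵥ v := by
  rw [mul_vecMulVec, trace_vecMulVec, dotProduct_comm]

theorem Matrix.trace_mul_exp_vecMulVec_le {A : Matrix m m ℝ} (hA : A.PosSemidef) {v : m → ℝ}
    {R : ℝ} (hR : 0 < R) (hv : v ⬝ᵥ v ≤ R) (θ : ℝ) :
    (A * NormedSpace.exp (θ • vecMulVec v v)).trace ≤
      A.trace + (Real.exp (θ * R) - 1) / R * (v ⬝ᵥ A *ᵥ v) := by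
  by_cases hv0 : v = 0
  · simp [hv0]
  have hr : 0 < v ⬝ᵥ v := by
    simpa using Matrix.dotProduct_star_self_pos_iff.2 hv0
  set r := v ⬝ᵥ v with hrdef
  have hq : 0 ≤ v ⬝ᵥ A *ᵥ v := by simpa using hA.dotProduct_mulVec_nonneg v
  have hp : (r⁻¹ • vecMulVec v v) * (r⁻¹ • vecMulVec v v) = r⁻¹ • vecMulVec v v := by
    rw [smul_mul_smul_comm, vecMulVec_mul_vecMulVec, ← hrdef, vecMulVec_smul, smul_smul]
    congr 1
    field_simp
  have hexp : NormedSpace.exp (θ • vecMulVec v v) =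
      1 + (Real.exp (θ * r) - 1) • r⁻¹ • vecMulVec v v := by
    rw [← exp_smul_of_isIdempotentElem hp, smul_smul, mul_assoc, mul_inv_cancel₀ hr.ne', mul_one]
  rw [hexp, mul_add, mul_one, trace_add, Matrix.mul_smul, Matrix.mul_smul, trace_smul, trace_smul,
    trace_mul_vecMulVec, smul_eq_mul, smul_eq_mul, ← mul_assoc]
  gcongr
  rw [← div_eq_mul_inv, div_le_iff₀ hr, mul_comm (_ / R)]
  exact Real.exp_mul_sub_one_le hr.le hv hR

end Exp

section OpNorm

open scoped Matrix.Norms.L2Operator in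
theorem matOpNorm_transpose {m n : ℕ} (A : Matrix (Fin m) (Fin n) ℝ) :
    matOpNorm Aᵀ = matOpNorm A := by
  have h := l2_opNorm_conjTranspose A
  rw [conjTranspose_eq_transpose_of_trivial, l2_opNorm_def, l2_opNorm_def] at h
  exact h

theorem matOpNorm_le {m n : ℕ} {A : Matrix (Fin m) (Fin n) ℝ} {c : ℝ} (hc : 0 ≤ c)
    (h : ∀ u, (A *ᵥ u) ⬝ᵥ (A *ᵥ u) ≤ c ^ 2 * (u ⬝ᵥ u)) : matOpNorm A ≤ c := by
  refine ContinuousLinearMap.opNorm_le_bound _ hc fun x => ?_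
  have hnorm : ∀ {l : ℕ} (y : EuclideanSpace ℝ (Fin l)), ‖y‖ ^ 2 = y.ofLp ⬝ᵥ y.ofLp := fun y => by
    rw [EuclideanSpace.norm_sq_eq]
    simp [dotProduct, pow_two]
  refine le_of_sq_le_sq ?_ (by positivity)
  rw [mul_pow, hnorm, hnorm]
  exact h x.ofLp

theorem matOpNorm_inv_gram_le {k N : ℕ} (hN : 0 < N) {F : Matrix (Fin k) (Fin N) ℝ}
    (hlow : ∀ u, N / 2 * (u ⬝ᵥ u) ≤ u ⬝ᵥ (F * Fᵀ) *ᵥ u) :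
    matOpNorm ((1 / (N : ℝ)) • (F * Fᵀ))⁻¹ ≤ 2 := by
  have hN' : (0 : ℝ) < N := by exact_mod_cast hN
  set G := (1 / (N : ℝ)) • (F * Fᵀ) with hG
  have hGlow : ∀ u, (u ⬝ᵥ u) ≤ 2 * (u ⬝ᵥ G *ᵥ u) := fun u => by
    rw [hG, smul_mulVec, dotProduct_smul, smul_eq_mul]
    have := hlow u
    field_simp
    linarith
  have hinj : Function.Injective G.mulVec := by
    refine (injective_iff_map_eq_zero G.mulVecLin).2 fun u hu => ?_
    have h := hGlow u
    rw [mulVecLin_apply] at hu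
    rw [hu, dotProduct_zero, mul_zero] at h
    exact dotProduct_self_eq_zero.1 (h.antisymm (by simpa using dotProduct_star_self_nonneg u))
  have hunit := (isUnit_iff_isUnit_det _).1 (mulVec_injective_iff_isUnit.1 hinj)
  refine matOpNorm_le (by norm_num) fun x => ?_
  set y := G⁻¹ *ᵥ x with hy
  have hGy : G *ᵥ y = x := by rw [hy, mulVec_mulVec, mul_nonsing_inv _ hunit, one_mulVec]
  have h1 := hGlow y
  rw [hGy] at h1
  have h2 : 0 ≤ (y - (2 : ℝ) • x) ⬝ᵥ (y - (2 : ℝ) • x) := by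
    simpa using dotProduct_star_self_nonneg (y - (2 : ℝ) • x)
  simp only [sub_dotProduct, dotProduct_sub, smul_dotProduct, dotProduct_smul, smul_eq_mul,
    dotProduct_comm x y] at h2
  linarith

theorem matOpNorm_le_of_gram_le {k N : ℕ} {F : Matrix (Fin k) (Fin N) ℝ} {c : ℝ} (hc : 0 ≤ c)
    (hup : ∀ u, u ⬝ᵥ (F * Fᵀ) *ᵥ u ≤ c ^ 2 * (u ⬝ᵥ u)) : matOpNorm F ≤ c := by
  rw [← matOpNorm_transpose]
  refine matOpNorm_le hc fun u => (le_of_eq ?_).trans (hup u)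
  rw [← mulVec_mulVec, dotProduct_mulVec u, ← mulVec_transpose]

end OpNorm

section Tail

open NormedSpace

/-- The vector of features at a point. -/
def featureVec {X : Type*} {k : ℕ} (f : Fin k → X → ℝ) (x : X) : Fin k → ℝ := fun i => f i x

variable {X : Type*} [MeasurableSpace X] {P : Measure X} [IsProbabilityMeasure P]
  {k : ℕ} {f : Fin k → X → ℝ} {M R : ℝ}

omit [MeasurableSpace X] in
theorem featureMatrix_mul_transpose (f : Fin k → X → ℝ) {N : ℕ} (ω : Fin N → X) :
    (Matrix.of fun i j => f i (ω j)) * (Matrix.of fun i j => f i (ω j))ᵀ =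
      ∑ j, vecMulVec (featureVec f (ω j)) (featureVec f (ω j)) := by
  ext a b
  simp [Matrix.mul_apply, Matrix.sum_apply, vecMulVec_apply, featureVec]

omit [MeasurableSpace X] in
theorem featureVec_dotProduct_self_le (hfM : ∀ j x, |f j x| ≤ M) (x : X) :
    featureVec f x ⬝ᵥ featureVec f x ≤ k * M ^ 2 := by
  have h : ∀ i ∈ Finset.univ, featureVec f x i * featureVec f x i ≤ M ^ 2 := fun i _ => by
    rw [← pow_two]
    exact sq_le_sq' (abs_le.1 (hfM i x)).1 (abs_le.1 (hfM i x)).2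
  simpa [dotProduct] using Finset.sum_le_sum h

theorem integrable_mul_features (hfm : ∀ j, Measurable (f j)) (hfM : ∀ j x, |f j x| ≤ M)
    (i j : Fin k) : Integrable (fun x => f i x * f j x) P := by
  refine Integrable.of_bound ((hfm i).mul (hfm j)).aestronglyMeasurable (M * M) ?_
  refine Filter.Eventually.of_forall fun x => ?_
  rw [norm_mul]
  have h0 : 0 ≤ M := (abs_nonneg _).trans (hfM i x)
  exact mul_le_mul (hfM i x) (hfM j x) (norm_nonneg _) h0

omit [MeasurableSpace X] in
theorem dotProduct_mulVec_featureVec (A : Matrix (Fin k) (Fin k) ℝ) (x : X) :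
    featureVec f x ⬝ᵥ A *ᵥ featureVec f x = ∑ i, ∑ j, A i j * (f i x * f j x) := by
  simp only [dotProduct, mulVec, featureVec, Finset.mul_sum]
  exact Finset.sum_congr rfl fun i _ => Finset.sum_congr rfl fun j _ => by ring

theorem integrable_dotProduct_mulVec_featureVec (hfm : ∀ j, Measurable (f j))
    (hfM : ∀ j x, |f j x| ≤ M) (A : Matrix (Fin k) (Fin k) ℝ) :
    Integrable (fun x => featureVec f x ⬝ᵥ A *ᵥ featureVec f x) P := by
  simp only [dotProduct_mulVec_featureVec]
  exact integrable_finsetSum _ fun i _ => integrable_finsetSum _ fun j _ =>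
    (integrable_mul_features hfm hfM i j).const_mul _

theorem integral_dotProduct_mulVec_featureVec (hfm : ∀ j, Measurable (f j))
    (hfM : ∀ j x, |f j x| ≤ M)
    (horth : ∀ i j, ∫ x, f i x * f j x ∂P = if i = j then 1 else 0)
    (A : Matrix (Fin k) (Fin k) ℝ) :
    ∫ x, featureVec f x ⬝ᵥ A *ᵥ featureVec f x ∂P = A.trace := by
  simp only [dotProduct_mulVec_featureVec]
  have hrow : ∀ i, ∫ x, ∑ j, A i j * (f i x * f j x) ∂P = A i i := fun i =>
    (integral_finsetSum _ fun j _ => (integrable_mul_features hfm hfM i j).const_mul _).trans (by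
      simp [integral_const_mul, horth])
  refine (integral_finsetSum _ fun i _ => integrable_finsetSum _ fun j _ =>
    (integrable_mul_features hfm hfM i j).const_mul _).trans ?_
  simp [hrow, Matrix.trace]

open scoped Matrix.Norms.Operator in
theorem measurable_trace_exp_sum (hfm : ∀ j, Measurable (f j)) (θ : ℝ) (N : ℕ)
    {Y : Type*} [MeasurableSpace Y] (A : Matrix (Fin k) (Fin k) ℝ) {w : Y → Fin N → X}
    (hw : Measurable w) :
    Measurable fun y => (exp (A + θ • ∑ j,
      vecMulVec (featureVec f (w y j)) (featureVec f (w y j)))).trace := by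
  have h1 : Measurable fun y j => featureVec f (w y j) := by
    refine measurable_pi_lambda _ fun j => measurable_pi_lambda _ fun i => ?_
    exact (hfm i).comp ((measurable_pi_apply j).comp hw)
  have h2 : Continuous fun v : Fin N → Fin k → ℝ =>
      (exp (A + θ • ∑ j, vecMulVec (v j) (v j))).trace := by
    refine Continuous.matrix_trace (exp_continuous.comp ?_)
    refine continuous_const.add (Continuous.const_smul ?_ θ)
    exact continuous_finsetSum _ fun j _ =>
      (continuous_apply j).matrix_vecMulVec (continuous_apply j)
  exact h2.measurable.comp h1

theorem lintegral_trace_exp_add_le (hfm : ∀ j, Measurable (f j))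
    (horth : ∀ i j, ∫ x, f i x * f j x ∂P = if i = j then 1 else 0)
    (hfM : ∀ j x, |f j x| ≤ M) (hR : 0 < R) (hkR : k * M ^ 2 ≤ R) (θ : ℝ)
    {A : Matrix (Fin k) (Fin k) ℝ} (hA : Aᵀ = A) :
    ∫⁻ x, ENNReal.ofReal
        (exp (A + θ • vecMulVec (featureVec f x) (featureVec f x))).trace ∂P ≤
      ENNReal.ofReal (1 + (Real.exp (θ * R) - 1) / R) * ENNReal.ofReal (exp A).trace := by
  have hE := posSemidef_exp hA
  have hsymm : ∀ x, (θ • vecMulVec (featureVec f x) (featureVec f x))ᵀ =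
      θ • vecMulVec (featureVec f x) (featureVec f x) := fun x => by
    rw [transpose_smul, transpose_vecMulVec]
  set h : X → ℝ := fun x => (exp A).trace +
    (Real.exp (θ * R) - 1) / R * (featureVec f x ⬝ᵥ exp A *ᵥ featureVec f x) with hh
  have hle : ∀ x, (exp (A + θ • vecMulVec (featureVec f x) (featureVec f x))).trace ≤ h x :=
    fun x => (trace_exp_add_le hA (hsymm x)).trans (trace_mul_exp_vecMulVec_le hE hR
      ((featureVec_dotProduct_self_le hfM x).trans hkR) θ)
  have hnn : ∀ x, 0 ≤ h x := fun x => by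
    refine le_trans (posSemidef_exp ?_).trace_nonneg (hle x)
    rw [transpose_add, hA, hsymm]
  have hint := (integrable_dotProduct_mulVec_featureVec (P := P) hfm hfM (exp A)).const_mul
    ((Real.exp (θ * R) - 1) / R)
  calc _ ≤ ∫⁻ x, ENNReal.ofReal (h x) ∂P :=
        lintegral_mono fun x => ENNReal.ofReal_le_ofReal (hle x)
    _ = ENNReal.ofReal (∫ x, h x ∂P) :=
        (ofReal_integral_eq_lintegral_ofReal ((integrable_const _).add hint)
          (Filter.Eventually.of_forall hnn)).symm
    _ = ENNReal.ofReal ((1 + (Real.exp (θ * R) - 1) / R) * (exp A).trace) := by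
        rw [hh, integral_add (integrable_const _) hint, integral_const_mul,
          integral_dotProduct_mulVec_featureVec hfm hfM horth]
        simp [add_mul]
    _ = _ := ENNReal.ofReal_mul' hE.trace_nonneg

theorem lintegral_trace_exp_sum_le (hfm : ∀ j, Measurable (f j))
    (horth : ∀ i j, ∫ x, f i x * f j x ∂P = if i = j then 1 else 0)
    (hfM : ∀ j x, |f j x| ≤ M) (hR : 0 < R) (hkR : k * M ^ 2 ≤ R) (θ : ℝ) (N : ℕ)
    {A : Matrix (Fin k) (Fin k) ℝ} (hA : Aᵀ = A) :
    ∫⁻ ω, ENNReal.ofReal (exp (A + θ • ∑ j,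
        vecMulVec (featureVec f (ω j)) (featureVec f (ω j)))).trace
          ∂(Measure.pi fun _ : Fin N => P) ≤
      ENNReal.ofReal (1 + (Real.exp (θ * R) - 1) / R) ^ N * ENNReal.ofReal (exp A).trace := by
  induction N generalizing A with
  | zero => simp
  | succ N ih =>
    have hmp := (measurePreserving_piFinSuccAbove (fun _ : Fin (N + 1) => P) 0).symm
    rw [← hmp.lintegral_comp_emb (MeasurableEquiv.measurableEmbedding _),
      lintegral_prod _ ((measurable_trace_exp_sum hfm θ (N + 1) A
        (MeasurableEquiv.measurable _)).ennreal_ofReal.aemeasurable)]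
    simp only [MeasurableEquiv.piFinSuccAbove_symm_apply, Fin.insertNthEquiv, Equiv.coe_fn_mk,
      Fin.insertNth_zero', Fin.sum_univ_succ, Fin.cons_zero, Fin.cons_succ, smul_add, ← add_assoc]
    calc _ ≤ ∫⁻ x, ENNReal.ofReal (1 + (Real.exp (θ * R) - 1) / R) ^ N * ENNReal.ofReal
          (exp (A + θ • vecMulVec (featureVec f x) (featureVec f x))).trace ∂P :=
          lintegral_mono fun x => ih (by
            rw [transpose_add, hA, transpose_smul, transpose_vecMulVec])
      _ = ENNReal.ofReal (1 + (Real.exp (θ * R) - 1) / R) ^ N * ∫⁻ x, ENNReal.ofReal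
          (exp (A + θ • vecMulVec (featureVec f x) (featureVec f x))).trace ∂P :=
          lintegral_const_mul' _ _ (by finiteness)
      _ ≤ _ := by
          rw [pow_succ, mul_assoc]
          gcongr
          exact lintegral_trace_exp_add_le hfm horth hfM hR hkR θ hA

/-- A matrix Chernoff tail bound for sums of rank-one matrices of bounded features. -/
theorem measure_exp_le_trace_exp_sum_le (hfm : ∀ j, Measurable (f j))
    (horth : ∀ i j, ∫ x, f i x * f j x ∂P = if i = j then 1 else 0)
    (hfM : ∀ j x, |f j x| ≤ M) (hR : 0 < R) (hkR : k * M ^ 2 ≤ R) (θ : ℝ) (N : ℕ) (c : ℝ) :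
    Measure.pi (fun _ : Fin N => P) {ω | Real.exp (N * c) ≤ (exp (θ • ∑ j,
        vecMulVec (featureVec f (ω j)) (featureVec f (ω j)))).trace} ≤
      ENNReal.ofReal (k * Real.exp (N * ((Real.exp (θ * R) - 1) / R - c))) := by
  have hm := measurable_trace_exp_sum hfm θ N (0 : Matrix (Fin k) (Fin k) ℝ) measurable_id
  have hb := lintegral_trace_exp_sum_le hfm horth hfM hR hkR θ N
    (A := (0 : Matrix (Fin k) (Fin k) ℝ)) transpose_zero
  simp only [zero_add, id, exp_zero, trace_one, Fintype.card_fin] at hm hb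
  have hmarkov := meas_ge_le_lintegral_div (μ := Measure.pi fun _ : Fin N => P)
    hm.ennreal_ofReal.aemeasurable (ε := ENNReal.ofReal (Real.exp (N * c)))
    (by simpa using Real.exp_pos _) (by finiteness)
  refine (measure_mono fun ω hω => ENNReal.ofReal_le_ofReal hω).trans (hmarkov.trans ?_)
  refine ENNReal.div_le_of_le_mul (hb.trans ?_)
  calc _ ≤ ENNReal.ofReal (Real.exp ((Real.exp (θ * R) - 1) / R)) ^ N * ENNReal.ofReal k := by
        gcongr
        linarith [Real.add_one_le_exp ((Real.exp (θ * R) - 1) / R)]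
    _ = _ := by
        rw [← ENNReal.ofReal_pow (by positivity), ← ENNReal.ofReal_mul (by positivity),
          ← ENNReal.ofReal_mul (by positivity), ← Real.exp_nat_mul, mul_assoc, ← Real.exp_add,
          mul_comm, ← mul_add, sub_add_cancel]

end Tail

section GoodEvent

theorem matOpNorm_gram_bounds {k N : ℕ} (hN : 0 < N) {F : Matrix (Fin k) (Fin N) ℝ}
    (hlow : ∀ u, N / 2 * (u ⬝ᵥ u) ≤ u ⬝ᵥ (F * Fᵀ) *ᵥ u)
    (hup : ∀ u, u ⬝ᵥ (F * Fᵀ) *ᵥ u ≤ 3 * N / 2 * (u ⬝ᵥ u)) :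
    matOpNorm ((1 / (N : ℝ)) • (F * Fᵀ))⁻¹ ≤ 2 ∧
      matOpNorm ((1 / (N : ℝ)) • (F * Fᵀ))⁻¹ * matOpNorm F ≤ Real.sqrt (6 * N) := by
  have h1 := matOpNorm_inv_gram_le hN hlow
  have h2 : matOpNorm F ≤ Real.sqrt (3 * N / 2) :=
    matOpNorm_le_of_gram_le (Real.sqrt_nonneg _) fun u => by
      rw [Real.sq_sqrt (by positivity)]; exact hup u
  refine ⟨h1, (mul_le_mul h1 h2 (norm_nonneg _) zero_le_two).trans_eq ?_⟩
  rw [show (6 * N : ℝ) = 2 ^ 2 * (3 * N / 2) by ring, Real.sqrt_mul (by positivity),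
    Real.sqrt_sq zero_le_two]

theorem Real.exp_two_fifths_lt : Real.exp (2 / 5) < 1.492 := by
  have h := Real.exp_bound' (x := 2 / 5) (by norm_num) (by norm_num) (n := 5) (by norm_num)
  norm_num [Finset.sum_range_succ, Nat.factorial] at h
  linarith

theorem Real.exp_neg_half_lt : Real.exp (-(1 / 2)) < 0.64 := by
  have h := Real.quadratic_le_exp_of_nonneg (x := 1 / 2) (by norm_num)
  rw [Real.exp_neg, inv_lt_comm₀ (Real.exp_pos _) (by norm_num)]
  norm_num at h ⊢
  linarith

theorem chernoff_exponent_le {R s x : ℝ} (hR : 0 < R) (hs : s ≤ -(3 / 28)) {N : ℕ}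
    (hx : x = s / R) : Real.exp (N * x) ≤ Real.exp (-(N : ℝ) / ((28 / 3) * R + 4 / 3)) := by
  rw [Real.exp_le_exp, neg_div, div_eq_mul_inv, ← mul_neg, hx]
  gcongr
  rw [le_neg, ← neg_div, inv_le_comm₀ (by positivity) (div_pos (by linarith) hR), inv_div,
    div_le_iff₀ (by linarith)]
  nlinarith

variable {X : Type*} [MeasurableSpace X] {P : Measure X} [IsProbabilityMeasure P]
  {k : ℕ} {f : Fin k → X → ℝ} {M : ℝ}

omit [MeasurableSpace X] in
theorem featureMatrix_quadraticForm_le {N : ℕ} {ω : Fin N → X} {θ c : ℝ}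
    (h : ¬ Real.exp (N * c) ≤ (NormedSpace.exp (θ • ∑ j,
      vecMulVec (featureVec f (ω j)) (featureVec f (ω j)))).trace) (u : Fin k → ℝ) :
    θ * (u ⬝ᵥ ((Matrix.of fun i j => f i (ω j)) * (Matrix.of fun i j => f i (ω j))ᵀ) *ᵥ u) ≤
      N * c * (u ⬝ᵥ u) := by
  rw [featureMatrix_mul_transpose, ← smul_eq_mul θ, ← dotProduct_smul, ← smul_mulVec]
  refine dotProduct_mulVec_le_of_trace_exp_le ?_ (not_le.1 h).le u
  simp [transpose_sum, transpose_vecMulVec]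

omit [IsProbabilityMeasure P] in
theorem bound_pos_of_orthonormal (hM : 0 ≤ M) (hk : 0 < k) (hfM : ∀ j x, |f j x| ≤ M)
    (horth : ∀ i j, ∫ x, f i x * f j x ∂P = if i = j then 1 else 0) : 0 < M := by
  refine hM.lt_of_ne fun h0 => ?_
  have hf : ∀ x, f ⟨0, hk⟩ x = 0 := fun x => abs_nonpos_iff.1 (h0 ▸ hfM ⟨0, hk⟩ x)
  simpa [hf] using horth ⟨0, hk⟩ ⟨0, hk⟩

end GoodEvent

/-- With probability at least `1 − 2k·exp(−N/((28/3)kM² + 4/3))`,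
the empirical Gram matrix `(1/N)FFᵀ` of orthonormal bounded features satisfies
`‖((1/N)FFᵀ)⁻¹‖ ≤ 2` and `‖((1/N)FFᵀ)⁻¹‖·‖F‖ ≤ √(6N)`. -/
theorem empirical_gram_good_event
    {X : Type*} [MeasurableSpace X] (P : Measure X) [IsProbabilityMeasure P]
    {k : ℕ} (f : Fin k → X → ℝ) (hfm : ∀ j, Measurable (f j))
    (horth : ∀ i j, ∫ x, f i x * f j x ∂P = if i = j then 1 else 0)
    (M : ℝ) (hM : 0 ≤ M) (hfM : ∀ j x, |f j x| ≤ M)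
    (N : ℕ) (hN : 0 < N) :
    1 - 2 * k * Real.exp (-(N : ℝ) / ((28 / 3) * k * M ^ 2 + 4 / 3))
      ≤ ((Measure.pi fun _ : Fin N => P)
          {ω | matOpNorm (((1 / (N : ℝ)) •
                  ((Matrix.of fun i j => f i (ω j)) * (Matrix.of fun i j => f i (ω j))ᵀ))⁻¹) ≤ 2
            ∧ matOpNorm (((1 / (N : ℝ)) •
                  ((Matrix.of fun i j => f i (ω j)) * (Matrix.of fun i j => f i (ω j))ᵀ))⁻¹)
                * matOpNorm (Matrix.of fun i j => f i (ω j))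
              ≤ Real.sqrt (6 * N)}).toReal := by
  rcases Nat.eq_zero_or_pos k with rfl | hk
  · have h : ∀ ω : Fin N → X, _ := fun ω =>
      matOpNorm_gram_bounds hN (F := Matrix.of fun i j => f i (ω j)) (by simp) (by simp)
    simp only [h, and_self, Set.ofPred_true, measure_univ]
    simp
  set R : ℝ := k * M ^ 2 with hRdef
  have hMpos := bound_pos_of_orthonormal hM hk hfM horth
  have hR : 0 < R := by positivity
  set p := Real.exp (-(N : ℝ) / ((28 / 3) * k * M ^ 2 + 4 / 3)) with hp
  have hpR : p = Real.exp (-(N : ℝ) / ((28 / 3) * R + 4 / 3)) := by rw [hp, hRdef, mul_assoc]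
  set μ := Measure.pi fun _ : Fin N => P
  let bad (θ c : ℝ) : Set (Fin N → X) := {ω | Real.exp (N * c) ≤ (NormedSpace.exp (θ • ∑ j,
    vecMulVec (featureVec f (ω j)) (featureVec f (ω j)))).trace}
  have hbad : ∀ θ c s, (Real.exp (θ * R) - 1) / R - c = s / R → s ≤ -(3 / 28) →
      μ (bad θ c) ≤ ENNReal.ofReal (k * p) := fun θ c s h hs => by
    refine (measure_exp_le_trace_exp_sum_le hfm horth hfM hR le_rfl θ N c).trans ?_
    rw [hpR]
    gcongr ENNReal.ofReal (_ * ?_)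
    exact chernoff_exponent_le hR hs h
  have hupper := hbad (2 / 5 / R) (3 / 2 * (2 / 5 / R)) (Real.exp (2 / 5) - 1 - 3 / 5)
    (by rw [div_mul_cancel₀ _ hR.ne']; field_simp)
    (by linarith [Real.exp_two_fifths_lt])
  have hlower := hbad (-(1 / 2) / R) (1 / 2 * (-(1 / 2) / R)) (Real.exp (-(1 / 2)) - 1 + 1 / 4)
    (by rw [div_mul_cancel₀ _ hR.ne']; field_simp; ring)
    (by linarith [Real.exp_neg_half_lt])
  set B := bad (2 / 5 / R) (3 / 2 * (2 / 5 / R)) ∪ bad (-(1 / 2) / R) (1 / 2 * (-(1 / 2) / R))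
    with hB
  have hBμ : μ.real B ≤ 2 * k * p := by
    refine ENNReal.toReal_le_of_le_ofReal (by positivity) ((measure_union_le _ _).trans ?_)
    refine (add_le_add hupper hlower).trans_eq ?_
    rw [← ENNReal.ofReal_add (by positivity) (by positivity)]
    ring_nf
  have hcompl : 1 - μ.real B ≤ μ.real Bᶜ := by
    have h := measureReal_union_le (μ := μ) B Bᶜ
    rw [Set.union_compl_self, probReal_univ] at h
    linarith
  refine le_trans (by linarith) (hcompl.trans (measureReal_mono fun ω hω => ?_))
  rw [hB, Set.compl_union] at hω
  refine matOpNorm_gram_bounds hN (fun u => ?_) fun u => ?_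
  · have h := featureMatrix_quadraticForm_le hω.2 u
    have hθ : -(1 / 2) / R < 0 := div_neg_of_neg_of_pos (by norm_num) hR
    refine (mul_le_mul_left_of_neg hθ).1 (h.trans_eq ?_)
    ring
  · have h := featureMatrix_quadraticForm_le hω.1 u
    have hθ : 0 < 2 / 5 / R := by positivity
    refine le_of_mul_le_mul_left (h.trans_eq ?_) hθ
    ring
end
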